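/- Let B : [0,∞) → ℝ be a continuous function and let ℓ : ℝ × [0,∞) → [0,∞) be a jointly continuous function such that for every y ∈ ℝ and every t ≥ 0, ℓ(y,t) = lim_{ε→0⁺} (2ε)⁻¹ · Leb{u ∈ [0,t] : |B(u) − y| < ε}, and such that for every y ∈ ℝ, sup_{t≥0} ℓ(y,t) = ∞. Then for every y ∈ ℝ and every s > 0, the set {t ≥ 0 : ℓ(y,t) < s} is nonempty and bounded, and its supremum T satisfies ℓ(y,T) = s and B(T) = y; that is, the path t ↦ (B(t), ℓ(B(t), t)) visits the point (y,s) at time T. -/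

import Mathlib

open MeasureTheory Filter Set

/-- The occupation-density property: `ℓ y t` is the limit as `ε → 0⁺` of
`(2ε)⁻¹ · Leb {u ∈ [0,t] : |B u − y| < ε}`. -/
def OccupationDensity (B : ℝ → ℝ) (ℓ : ℝ → ℝ → ℝ) : Prop :=
  ∀ y t : ℝ, 0 ≤ t →
    Tendsto (fun ε : ℝ =>
        (volume {u ∈ Icc (0:ℝ) t | |B u - y| < ε}).toReal / (2 * ε))
      (nhdsWithin 0 (Ioi 0)) (nhds (ℓ y t))

namespace OccupationDensity

variable {B : ℝ → ℝ} {ℓ : ℝ → ℝ → ℝ}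

theorem apply_zero (h : OccupationDensity B ℓ) (y : ℝ) : ℓ y 0 = 0 := by
  refine tendsto_nhds_unique (h y 0 le_rfl) (tendsto_const_nhds.congr fun ε => ?_)
  have hnull : volume {u ∈ Icc (0 : ℝ) 0 | |B u - y| < ε} = 0 :=
    measure_mono_null (t := {0}) (fun u hu => by simpa using hu.1) (by simp)
  rw [hnull, ENNReal.toReal_zero, zero_div]

theorem monotoneOn (h : OccupationDensity B ℓ) (y : ℝ) : MonotoneOn (ℓ y) (Ici 0) := by
  intro a ha b hb hab
  refine le_of_tendsto_of_tendsto (h y a ha) (h y b hb) ?_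
  filter_upwards [self_mem_nhdsWithin] with ε hε
  have hε' : (0 : ℝ) < ε := hε
  have hfin : volume {u ∈ Icc (0 : ℝ) b | |B u - y| < ε} ≠ ⊤ :=
    measure_ne_top_of_subset (sep_subset _ _) (by simp)
  refine div_le_div_of_nonneg_right (ENNReal.toReal_mono hfin (measure_mono ?_)) (by positivity)
  exact fun u hu => ⟨⟨hu.1.1, hu.1.2.trans hab⟩, hu.2⟩

/-- The occupation density at `y` does not increase while the path stays away from `y`. -/
theorem eq_of_forall_le_abs_sub (h : OccupationDensity B ℓ) {y a b δ : ℝ} (ha : 0 ≤ a)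
    (hab : a ≤ b) (hδ : 0 < δ) (haway : ∀ u ∈ Ioc a b, δ ≤ |B u - y|) : ℓ y a = ℓ y b := by
  refine tendsto_nhds_unique (h y a ha) ((h y b (ha.trans hab)).congr' ?_)
  filter_upwards [mem_nhdsWithin_of_mem_nhds (Iio_mem_nhds hδ)] with ε hε
  have hset : {u ∈ Icc (0 : ℝ) b | |B u - y| < ε} = {u ∈ Icc (0 : ℝ) a | |B u - y| < ε} := by
    ext u
    refine ⟨fun hu => ⟨⟨hu.1.1, ?_⟩, hu.2⟩, fun hu => ⟨⟨hu.1.1, hu.1.2.trans hab⟩, hu.2⟩⟩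
    by_contra! hau
    exact absurd (haway u ⟨hau, hu.1.2⟩) (not_le.2 (hu.2.trans hε))
  rw [hset]

end OccupationDensity

theorem bricklayer_visits_target
    (B : ℝ → ℝ) (ℓ : ℝ → ℝ → ℝ)
    (hB : ContinuousOn B (Ici 0))
    (hℓnn : ∀ y t : ℝ, 0 ≤ t → 0 ≤ ℓ y t)
    (hℓcont : ContinuousOn (fun p : ℝ × ℝ => ℓ p.1 p.2) (univ ×ˢ Ici 0))
    (hocc : OccupationDensity B ℓ)
    (hunb : ∀ y M : ℝ, ∃ t : ℝ, 0 ≤ t ∧ M < ℓ y t)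
    (y s : ℝ) (hs : 0 < s) :
    {t : ℝ | 0 ≤ t ∧ ℓ y t < s}.Nonempty ∧
      BddAbove {t : ℝ | 0 ≤ t ∧ ℓ y t < s} ∧
      ℓ y (sSup {t : ℝ | 0 ≤ t ∧ ℓ y t < s}) = s ∧
      B (sSup {t : ℝ | 0 ≤ t ∧ ℓ y t < s}) = y := by
  have hmono := hocc.monotoneOn y
  have hzero := hocc.apply_zero y
  have hcont : ContinuousOn (ℓ y) (Ici 0) :=
    hℓcont.comp (f := fun t : ℝ => (y, t)) (by fun_prop) fun t ht => ⟨mem_univ _, ht⟩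
  set S := {t : ℝ | 0 ≤ t ∧ ℓ y t < s} with hS
  have h0S : (0 : ℝ) ∈ S := ⟨le_rfl, by rwa [hzero]⟩
  obtain ⟨t₁, ht₁, hst₁⟩ := hunb y s
  obtain ⟨c, hc, hcs⟩ : s ∈ ℓ y '' Icc 0 t₁ :=
    intermediate_value_Icc ht₁ (hcont.mono Icc_subset_Ici_self) ⟨by rw [hzero]; exact hs.le, hst₁.le⟩
  have hub : c ∈ upperBounds S := by
    intro t ht
    by_contra! hct
    exact absurd (hmono hc.1 ht.1 hct.le) (not_le.2 (hcs ▸ ht.2))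
  have hbdd : BddAbove S := ⟨c, hub⟩
  have hT0 : 0 ≤ sSup S := le_csSup hbdd h0S
  have hTc : sSup S ≤ c := csSup_le ⟨0, h0S⟩ hub
  have hTs : ℓ y (sSup S) = s := by
    refine le_antisymm (hcs ▸ hmono hT0 hc.1 hTc) ?_
    by_contra! hlt
    obtain ⟨v, hv, hvs⟩ := exists_between hlt
    obtain ⟨t, ht, htv⟩ : v ∈ ℓ y '' Icc (sSup S) c :=
      intermediate_value_Icc hTc (hcont.mono fun u hu => hT0.trans hu.1) ⟨hv.le, hcs ▸ hvs.le⟩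
    have ht0 : 0 ≤ t := hT0.trans ht.1
    have htT : t ≤ sSup S := le_csSup hbdd ⟨ht0, htv ▸ hvs⟩
    exact absurd (hmono ht0 hT0 htT) (not_le.2 (htv ▸ hv))
  refine ⟨⟨0, h0S⟩, hbdd, hTs, ?_⟩
  by_contra hne
  have hTpos : 0 < sSup S := hT0.lt_of_ne fun h => by rw [← h, hzero] at hTs; exact hs.ne hTs
  have hgap : 0 < |B (sSup S) - y| := abs_pos.2 (sub_ne_zero.2 hne)
  have haway : ∀ᶠ u in nhdsWithin (sSup S) (Ici 0), |B (sSup S) - y| / 2 < |B u - y| :=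
    ((hB (sSup S) hT0).sub_const y).abs.eventually_const_lt (half_lt_self hgap)
  rw [nhdsWithin_eq_nhds.2 (Ici_mem_nhds hTpos)] at haway
  obtain ⟨a, ha, hau⟩ := exists_Ioc_subset_of_mem_nhds' haway hTpos
  have heq : ℓ y a = ℓ y (sSup S) :=
    hocc.eq_of_forall_le_abs_sub ha.1 ha.2.le (half_pos hgap) fun u hu => le_of_lt (hau hu)
  obtain ⟨t, ht, hat⟩ := exists_lt_of_lt_csSup ⟨0, h0S⟩ ha.2
  exact absurd (hmono ha.1 ht.1 hat.le) (not_le.2 (by rw [heq, hTs]; exact ht.2))
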